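/- Let S be a nonempty compact topological space and let ℓ : ℝ^m × S → ℝ be continuous, such that for every δ ∈ S the map θ ↦ ℓ(θ, δ) is differentiable on ℝ^m and the map (θ, δ) ↦ ∇_θ ℓ(θ, δ) is continuous on ℝ^m × S. Fix θ₀ ∈ ℝ^m and suppose the maximizer set δ*(θ₀) = {δ ∈ S : ℓ(θ₀, δ) = max_{δ' ∈ S} ℓ(θ₀, δ')} is a singleton {δ*_{θ₀}}. Then the max-function φ(θ) = max_{δ ∈ S} ℓ(θ, δ) is differentiable at θ₀ and ∇φ(θ₀) = ∇_θ ℓ(θ₀, δ*_{θ₀}). -/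

import Mathlib

open Filter Topology

/-- If `δs` is the strict maximizer of `ℓ (θ₀, ·)` on a compact space, then for `θ` near `θ₀` the
maximizers of `ℓ (θ, ·)` lie in any prescribed neighbourhood of `δs`. -/
theorem eventually_forall_isMaxOn_mem {X S : Type*} [TopologicalSpace X] [TopologicalSpace S]
    [CompactSpace S] {ℓ : X × S → ℝ} (hcont : Continuous ℓ) {θ₀ : X} {δs : S}
    (hlt : ∀ δ, δ ≠ δs → ℓ (θ₀, δ) < ℓ (θ₀, δs)) {V : Set S} (hV : V ∈ 𝓝 δs) :
    ∀ᶠ θ in 𝓝 θ₀, ∀ δ, IsMaxOn (fun δ => ℓ (θ, δ)) Set.univ δ → δ ∈ V := by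
  have hK : IsCompact (interior V)ᶜ := isOpen_interior.isClosed_compl.isCompact
  have hsep : ∀ᶠ θ in 𝓝 θ₀, ∀ δ ∈ (interior V)ᶜ, ℓ (θ, δ) < ℓ (θ, δs) := by
    refine hK.eventually_forall_of_forall_eventually fun δ hδ => ?_
    have hne : δ ≠ δs := by
      rintro rfl
      exact hδ (mem_interior_iff_mem_nhds.2 hV)
    exact (isOpen_lt hcont (by fun_prop : Continuous fun p : X × S => ℓ (p.1, δs))).mem_nhds
      (hlt δ hne)
  filter_upwards [hsep] with θ hθ δ hmax
  by_contra hδ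
  exact (hθ δ fun h => hδ (interior_subset h)).not_ge (hmax (Set.mem_univ δs))

/-- If the partial derivative of `ℓ` in its first argument is continuous at `(θ₀, δs)`, then the
first-order expansions of `ℓ (·, δ)` at `θ₀` hold uniformly for `δ` near `δs`, with the derivative
taken at `δs`. -/
theorem eventually_norm_sub_sub_fderiv_le {E S : Type*} [NormedAddCommGroup E] [NormedSpace ℝ E]
    [TopologicalSpace S] {ℓ : E × S → ℝ} (hdiff : ∀ δ, Differentiable ℝ fun θ => ℓ (θ, δ))
    {θ₀ : E} {δs : S}
    (hgrad : ContinuousAt (fun p : E × S => fderiv ℝ (fun θ => ℓ (θ, p.2)) p.1) (θ₀, δs))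
    {c : ℝ} (hc : 0 < c) :
    ∃ V ∈ 𝓝 δs, ∀ᶠ θ in 𝓝 θ₀, ∀ δ ∈ V,
      ‖ℓ (θ, δ) - ℓ (θ₀, δ) - fderiv ℝ (fun θ => ℓ (θ, δs)) θ₀ (θ - θ₀)‖ ≤ c * ‖θ - θ₀‖ := by
  have hnear := hgrad.eventually (Metric.closedBall_mem_nhds _ hc)
  rw [nhds_prod_eq, eventually_prod_iff] at hnear
  obtain ⟨P, hP, Q, hQ, hPQ⟩ := hnear
  obtain ⟨r, hr, hrP⟩ := Metric.eventually_nhds_iff_ball.1 hP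
  refine ⟨{δ | Q δ}, hQ, ?_⟩
  filter_upwards [Metric.ball_mem_nhds θ₀ hr] with θ hθ δ hδ
  refine (convex_ball θ₀ r).norm_image_sub_le_of_norm_hasFDerivWithin_le'
    (f := fun θ => ℓ (θ, δ)) (fun x _ => (hdiff δ x).hasFDerivAt.hasFDerivWithinAt)
    (fun x hx => ?_) (Metric.mem_ball_self hr) hθ
  exact mem_closedBall_iff_norm.1 (hPQ (hrP x hx) hδ)


/-- **Danskin's theorem, singleton-maximizer part.**
Let `S` be a nonempty compact topological space and `ℓ : ℝ^m × S → ℝ` be continuous,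
differentiable in its first argument for every `δ ∈ S`, with `(θ, δ) ↦ ∇_θ ℓ(θ, δ)`
continuous.  If the maximizer set of `ℓ(θ₀, ·)` over `S` is the singleton `{δs}`,
then the max-function `φ(θ) = max_{δ ∈ S} ℓ(θ, δ)` is differentiable at `θ₀` with
`∇φ(θ₀) = ∇_θ ℓ(θ₀, δs)`. -/
theorem danskin_singleton_maximizer
    {m : ℕ} {S : Type*} [TopologicalSpace S] [CompactSpace S] [Nonempty S]
    (ℓ : EuclideanSpace ℝ (Fin m) × S → ℝ)
    (hcont : Continuous ℓ)
    (hdiff : ∀ δ : S, Differentiable ℝ (fun θ : EuclideanSpace ℝ (Fin m) => ℓ (θ, δ)))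
    (hgradcont : Continuous (fun p : EuclideanSpace ℝ (Fin m) × S =>
      fderiv ℝ (fun θ => ℓ (θ, p.2)) p.1))
    (θ₀ : EuclideanSpace ℝ (Fin m)) (δs : S)
    (hsingleton : {δ : S | ℓ (θ₀, δ) = ⨆ δ' : S, ℓ (θ₀, δ')} = {δs}) :
    HasFDerivAt (fun θ : EuclideanSpace ℝ (Fin m) => ⨆ δ : S, ℓ (θ, δ))
      (fderiv ℝ (fun θ => ℓ (θ, δs)) θ₀) θ₀ := by
  have hbdd (θ) : BddAbove (Set.range fun δ => ℓ (θ, δ)) :=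
    (isCompact_range (by fun_prop)).bddAbove
  have hmax (θ) : ∃ δ, ℓ (θ, δ) = ⨆ δ', ℓ (θ, δ') :=
    (isCompact_range (by fun_prop : Continuous fun δ => ℓ (θ, δ))).sSup_mem
      (Set.range_nonempty _)
  have hs : ℓ (θ₀, δs) = ⨆ δ, ℓ (θ₀, δ) := hsingleton.ge rfl
  have hlt (δ) (hδ : δ ≠ δs) : ℓ (θ₀, δ) < ℓ (θ₀, δs) :=
    hs ▸ (le_ciSup (hbdd θ₀) δ).lt_of_ne fun h => hδ (hsingleton.le h)
  refine .of_isLittleO (Asymptotics.isLittleO_iff.2 fun c hc => ?_)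
  obtain ⟨V, hV, hexp⟩ :=
    eventually_norm_sub_sub_fderiv_le hdiff (hgradcont.continuousAt (x := (θ₀, δs))) hc
  filter_upwards [hexp, eventually_forall_isMaxOn_mem hcont hlt hV] with θ hθ hmem
  obtain ⟨δ, hδ⟩ := hmax θ
  have hδV : δ ∈ V := hmem δ fun δ' _ => (le_ciSup (hbdd θ) δ').trans_eq hδ.symm
  have hupper := hθ δ hδV
  have hlower := hθ δs (mem_of_mem_nhds hV)
  have hle := le_ciSup (hbdd θ) δs
  have hle₀ := le_ciSup (hbdd θ₀) δ
  rw [Real.norm_eq_abs, abs_le] at hupper hlower ⊢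
  constructor <;> linarith
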